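/- Let N be a complete normal subgroup of an n-space group Γ, let W = Span(Z(N)), let L = {u ∈ Eⁿ : u + I ∈ Z(N)}, let 𝒦 = W/L, and let κ : W → 𝒦 be the quotient map of (Γ/N)-modules. Then the cokernel of the induced homomorphism κ_* : H¹(Γ/N, W) → H¹(Γ/N, 𝒦) on first group cohomology is finite. -/

import Mathlib

noncomputable section

/-- The translation `x ↦ a + x` of a normed additive group, as an isometry. -/
def transIso {X : Type*} [SeminormedAddCommGroup X] (a : X) : X ≃ᵢ X :=
  IsometryEquiv.constVAdd a

@[simp] lemma transIso_apply {X : Type*} [SeminormedAddCommGroup X] (a x : X) :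
    transIso a x = a + x := rfl

/-- `parts φ a A` means that the isometry `φ` is `a + A`, i.e. `φ x = a + A x` for all `x`. -/
def parts {X : Type*} [NormedAddCommGroup X] [InnerProductSpace ℝ X]
    (φ : X ≃ᵢ X) (a : X) (A : X ≃ₗᵢ[ℝ] X) : Prop :=
  ∀ x, φ x = a + A x

/-- The span of a group of isometries: the real span of the set of translation vectors of
the translations belonging to the group. -/
def spanOf {X : Type*} [NormedAddCommGroup X] [InnerProductSpace ℝ X]
    (H : Subgroup (X ≃ᵢ X)) : Submodule ℝ X :=
  Submodule.span ℝ {a : X | transIso a ∈ H}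

/-- A space group: a group of isometries acting discontinuously (the discreteness condition)
with compact quotient (expressed by a compact set meeting every orbit). -/
def IsSpaceGroup {X : Type*} [MetricSpace X] (Γ : Subgroup (X ≃ᵢ X)) : Prop :=
  (∀ K : Set X, IsCompact K →
    {γ : X ≃ᵢ X | γ ∈ Γ ∧ ((γ : X → X) '' K ∩ K).Nonempty}.Finite) ∧
  ∃ K : Set X, IsCompact K ∧ ∀ x : X, ∃ γ ∈ Γ, (γ : X → X) x ∈ K

/-- `N` is a complete normal subgroup of `Γ`: it is normal in `Γ` and consists exactly of
those `a + A ∈ Γ` with `a ∈ Span N` and `A` fixing `(Span N)ᗮ` pointwise. -/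
def IsCompleteNormal {X : Type*} [NormedAddCommGroup X] [InnerProductSpace ℝ X]
    (Γ N : Subgroup (X ≃ᵢ X)) : Prop :=
  N ≤ Γ ∧ (∀ γ ∈ Γ, ∀ ν ∈ N, γ * ν * γ⁻¹ ∈ N) ∧
  ∀ φ ∈ Γ, ∀ (a : X) (A : X ≃ₗᵢ[ℝ] X), parts φ a A →
    (φ ∈ N ↔ a ∈ spanOf N ∧ ∀ w ∈ (spanOf N)ᗮ, A w = w)

/-- The real span of the set of translation vectors of the central translations of `N`,
i.e. `Span(Z(N))`. -/
def centerSpan {X : Type*} [NormedAddCommGroup X] [InnerProductSpace ℝ X]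
    (N : Subgroup (X ≃ᵢ X)) : Submodule ℝ X :=
  Submodule.span ℝ
    {u : X | ∃ h : transIso u ∈ N, (⟨transIso u, h⟩ : N) ∈ Subgroup.center N}


/-- The lattice `L = {u : u + I ∈ Z(N)}` of translation vectors of central translations
of `N`. -/
def Lset {X : Type*} [NormedAddCommGroup X] [InnerProductSpace ℝ X]
    (N : Subgroup (X ≃ᵢ X)) : Set X :=
  {u : X | ∃ h : transIso u ∈ N, (⟨transIso u, h⟩ : N) ∈ Subgroup.center N}

/-- `IsNCocycleModL Γ N f` says that `f`, a function on `Γ` with values in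
`W = Span(Z(N))`, represents a crossed homomorphism `Γ/N → 𝒦 = W/L`. -/
def IsNCocycleModL {n : ℕ}
    (Γ N : Subgroup (EuclideanSpace ℝ (Fin n) ≃ᵢ EuclideanSpace ℝ (Fin n)))
    (f : Γ → EuclideanSpace ℝ (Fin n)) : Prop :=
  (∀ γ : Γ, f γ ∈ centerSpan N) ∧
  (∀ ν γ : Γ, (ν : EuclideanSpace ℝ (Fin n) ≃ᵢ EuclideanSpace ℝ (Fin n)) ∈ N →
    f (ν * γ) - f γ ∈ Lset N) ∧
  (∀ (γ₁ γ₂ : Γ) (b₁ : EuclideanSpace ℝ (Fin n))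
    (B₁ : EuclideanSpace ℝ (Fin n) ≃ₗᵢ[ℝ] EuclideanSpace ℝ (Fin n)),
    parts (γ₁ : EuclideanSpace ℝ (Fin n) ≃ᵢ EuclideanSpace ℝ (Fin n)) b₁ B₁ →
    f (γ₁ * γ₂) - (f γ₁ + B₁ (f γ₂)) ∈ Lset N)

/-- `IsNCocycleToW Γ N F` says that `F` is a crossed homomorphism `Γ/N → W`, with
`W = Span(Z(N))`. -/
def IsNCocycleToW {n : ℕ}
    (Γ N : Subgroup (EuclideanSpace ℝ (Fin n) ≃ᵢ EuclideanSpace ℝ (Fin n)))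
    (F : Γ → EuclideanSpace ℝ (Fin n)) : Prop :=
  (∀ γ : Γ, F γ ∈ centerSpan N) ∧
  (∀ ν γ : Γ, (ν : EuclideanSpace ℝ (Fin n) ≃ᵢ EuclideanSpace ℝ (Fin n)) ∈ N →
    F (ν * γ) = F γ) ∧
  (∀ (γ₁ γ₂ : Γ) (b₁ : EuclideanSpace ℝ (Fin n))
    (B₁ : EuclideanSpace ℝ (Fin n) ≃ₗᵢ[ℝ] EuclideanSpace ℝ (Fin n)),
    parts (γ₁ : EuclideanSpace ℝ (Fin n) ≃ᵢ EuclideanSpace ℝ (Fin n)) b₁ B₁ →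
    F (γ₁ * γ₂) = F γ₁ + B₁ (F γ₂))

section LinearPart

variable {X : Type*} [NormedAddCommGroup X] [InnerProductSpace ℝ X]

/-- The linear part `A` of an isometry `a + A`. -/
def linPart (φ : X ≃ᵢ X) : X ≃ₗᵢ[ℝ] X :=
  φ.toRealAffineIsometryEquiv.linearIsometryEquiv

lemma parts_linPart (φ : X ≃ᵢ X) : parts φ (φ 0) (linPart φ) := by
  intro x
  have h := φ.toRealAffineIsometryEquiv.map_vadd 0 x
  simp only [vadd_eq_add, add_zero, IsometryEquiv.coeFn_toRealAffineIsometryEquiv] at h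
  rw [h, add_comm]
  rfl

lemma parts.linPart_apply {φ : X ≃ᵢ X} {b : X} {B : X ≃ₗᵢ[ℝ] X} (h : parts φ b B) (x : X) :
    linPart φ x = B x := by
  have h₁ := parts_linPart φ x
  have h₂ := h x
  have h₃ := h 0
  rw [B.map_zero, add_zero] at h₃
  rw [h₂, h₃] at h₁
  exact (add_left_cancel h₁).symm

lemma linPart_one (x : X) : linPart (1 : X ≃ᵢ X) x = x :=
  parts.linPart_apply (B := LinearIsometryEquiv.refl ℝ X) (b := 0)
    (fun y => by simp) x

lemma linPart_mul (φ ψ : X ≃ᵢ X) (x : X) : linPart (φ * ψ) x = linPart φ (linPart ψ x) := by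
  refine parts.linPart_apply (B := (linPart ψ).trans (linPart φ)) (b := φ (ψ 0)) (fun y => ?_) x
  rw [IsometryEquiv.mul_apply, parts_linPart ψ y, parts_linPart φ, parts_linPart φ (ψ 0), map_add,
    add_assoc]
  rfl

lemma conj_transIso (φ : X ≃ᵢ X) (u : X) : φ * transIso u * φ⁻¹ = transIso (linPart φ u) := by
  rw [mul_inv_eq_iff_eq_mul]
  ext x
  simp only [IsometryEquiv.mul_apply, transIso_apply]
  rw [parts_linPart φ (u + x), parts_linPart φ x, map_add]
  abel

end LinearPart

section Translations

variable {X : Type*} [NormedAddCommGroup X]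

lemma transIso_zero : transIso (0 : X) = 1 := by
  ext x; simp

lemma transIso_add (u v : X) : transIso (u + v) = transIso u * transIso v := by
  ext x; simp [add_assoc]

lemma transIso_neg (u : X) : transIso (-u) = (transIso u)⁻¹ := by
  rw [eq_inv_iff_mul_eq_one, ← transIso_add, neg_add_cancel, transIso_zero]

end Translations

section CentralTranslations

variable {X : Type*} [NormedAddCommGroup X] [InnerProductSpace ℝ X]

lemma mem_Lset_iff {N : Subgroup (X ≃ᵢ X)} {u : X} :
    u ∈ Lset N ↔ transIso u ∈ N ∧ ∀ ν ∈ N, ν * transIso u = transIso u * ν := by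
  simp only [Lset, Set.mem_ofPred_eq, Subgroup.mem_center_iff, Subtype.forall, Subtype.ext_iff,
    Subgroup.coe_mul, exists_prop]

/-- The set of central translation vectors of `N`, as an additive subgroup. -/
def centralLattice (N : Subgroup (X ≃ᵢ X)) : AddSubgroup X where
  carrier := Lset N
  zero_mem' := by
    rw [mem_Lset_iff, transIso_zero]
    exact ⟨N.one_mem, fun ν _ => by simp⟩
  add_mem' {u v} hu hv := by
    rw [mem_Lset_iff] at *
    rw [transIso_add]
    refine ⟨N.mul_mem hu.1 hv.1, fun ν hν => ?_⟩
    rw [← mul_assoc, hu.2 ν hν, mul_assoc, hv.2 ν hν, mul_assoc]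
  neg_mem' {u} hu := by
    rw [mem_Lset_iff] at *
    rw [transIso_neg]
    exact ⟨N.inv_mem hu.1, fun ν hν => (Commute.inv_right (hu.2 ν hν) : Commute _ _)⟩

lemma mem_centralLattice {N : Subgroup (X ≃ᵢ X)} {u : X} :
    u ∈ centralLattice N ↔ u ∈ Lset N := Iff.rfl

lemma linPart_mem_centralLattice {Γ N : Subgroup (X ≃ᵢ X)}
    (hN : ∀ γ ∈ Γ, ∀ ν ∈ N, γ * ν * γ⁻¹ ∈ N) {γ : X ≃ᵢ X} (hγ : γ ∈ Γ) {u : X}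
    (hu : u ∈ centralLattice N) : linPart γ u ∈ centralLattice N := by
  rw [mem_centralLattice, mem_Lset_iff] at *
  rw [← conj_transIso]
  refine ⟨hN γ hγ _ hu.1, fun ν hν => ?_⟩
  have h := hu.2 _ (hN γ⁻¹ (Γ.inv_mem hγ) ν hν)
  rw [inv_inv] at h
  calc ν * (γ * transIso u * γ⁻¹) = γ * (γ⁻¹ * ν * γ * transIso u) * γ⁻¹ := by group
    _ = γ * transIso u * γ⁻¹ * ν := by rw [h]; group

lemma linPart_mem_centerSpan {Γ N : Subgroup (X ≃ᵢ X)}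
    (hN : ∀ γ ∈ Γ, ∀ ν ∈ N, γ * ν * γ⁻¹ ∈ N) {γ : X ≃ᵢ X} (hγ : γ ∈ Γ) {u : X}
    (hu : u ∈ centerSpan N) : linPart γ u ∈ centerSpan N := by
  have h : centerSpan N ≤ (centerSpan N).comap (linPart γ).toLinearEquiv.toLinearMap :=
    Submodule.span_le.2 fun v hv =>
      Submodule.subset_span (linPart_mem_centralLattice hN hγ hv)
  exact h hu

/-- A group acting discontinuously has only finitely many translations of bounded length. -/
lemma finite_centralLattice_norm_le [ProperSpace X] {Γ N : Subgroup (X ≃ᵢ X)}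
    (hΓ : IsSpaceGroup Γ) (hN : N ≤ Γ) (R : ℝ) :
    {u | u ∈ centralLattice N ∧ ‖u‖ ≤ R}.Finite := by
  have hinj : Function.Injective (transIso : X → X ≃ᵢ X) := fun u v h => by
    simpa using DFunLike.congr_fun h (0 : X)
  by_cases hR : 0 ≤ R
  · refine Set.Finite.of_finite_image ((hΓ.1 _ (isCompact_closedBall (0 : X) R)).subset ?_)
      hinj.injOn
    rintro _ ⟨u, ⟨hu, huR⟩, rfl⟩
    exact ⟨hN (mem_Lset_iff.1 hu).1, u, ⟨0, by simpa using hR, by simp⟩, by simpa using huR⟩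
  · convert Set.finite_empty
    ext u
    simp only [Set.mem_ofPred_eq, Set.mem_empty_iff_false, iff_false, not_and, not_le]
    intro _
    linarith [norm_nonneg u]

end CentralTranslations

/-- A subgroup is cobounded in its finite-dimensional real span. -/
lemma AddSubgroup.exists_forall_mem_span_norm_sub_le {X : Type*} [NormedAddCommGroup X]
    [NormedSpace ℝ X] [FiniteDimensional ℝ X] (L : AddSubgroup X) :
    ∃ C : ℝ, ∀ x ∈ Submodule.span ℝ (L : Set X), ∃ y, x - y ∈ L ∧ ‖y‖ ≤ C := by
  obtain ⟨s, hsL, hs⟩ := Submodule.fg_span_iff_fg_span_finset_subset (L : Set X) |>.1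
    (IsNoetherian.noetherian (Submodule.span ℝ (L : Set X)))
  refine ⟨∑ v ∈ s, ‖v‖, fun x hx => ?_⟩
  rw [hs, Submodule.mem_span_finset] at hx
  obtain ⟨c, -, rfl⟩ := hx
  refine ⟨∑ v ∈ s, Int.fract (c v) • v, ?_, ?_⟩
  · rw [← Finset.sum_sub_distrib]
    refine sum_mem fun v hv => ?_
    rw [← sub_smul, Int.self_sub_fract, Int.cast_smul_eq_zsmul]
    exact zsmul_mem (hsL hv) _
  · refine (norm_sum_le _ _).trans (Finset.sum_le_sum fun v _ => ?_)
    rw [norm_smul, Real.norm_of_nonneg (Int.fract_nonneg _)]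
    exact mul_le_of_le_one_left (norm_nonneg v) (Int.fract_lt_one _).le

/-- A space group is finitely generated: every element is a product of elements of some fixed
finite subset. -/
lemma IsSpaceGroup.exists_finite_generating {X : Type*} [NormedAddCommGroup X]
    [InnerProductSpace ℝ X] [ProperSpace X] {Γ : Subgroup (X ≃ᵢ X)} (hΓ : IsSpaceGroup Γ) :
    ∃ T : Set Γ, T.Finite ∧ ∀ γ : Γ, ∃ l : List T, (l.map Subtype.val).prod = γ := by
  obtain ⟨hfin, K, hK, hcov⟩ := hΓ
  obtain ⟨R, hKR⟩ := hK.isBounded.subset_closedBall (0 : X)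
  have hR : 0 ≤ R := by
    obtain ⟨γ, -, h⟩ := hcov 0
    exact dist_nonneg.trans (Metric.mem_closedBall.1 (hKR h))
  have hnear : ∀ x : X, ∃ γ : Γ, dist ((γ : X ≃ᵢ X) 0) x ≤ R := fun x => by
    obtain ⟨γ, hγ, h⟩ := hcov x
    refine ⟨⟨γ, hγ⟩⁻¹, ?_⟩
    have h' := Metric.mem_closedBall.1 (hKR h)
    rw [← γ.dist_eq]
    simpa [dist_comm] using h'
  let T : Set Γ := {γ | ‖(γ : X ≃ᵢ X) 0‖ ≤ 2 * R + 1}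
  refine ⟨T, ?_, ?_⟩
  · refine Set.Finite.of_finite_image ((hfin _ (isCompact_closedBall (0 : X) (2 * R + 1))).subset ?_)
      Subtype.val_injective.injOn
    rintro _ ⟨γ, hγ, rfl⟩
    exact ⟨γ.2, (γ : X ≃ᵢ X) 0, ⟨0, by simp; linarith, rfl⟩, mem_closedBall_zero_iff.2 hγ⟩
  have key : ∀ (k : ℕ) (x : X), ‖x‖ ≤ k → ∀ γ : Γ, dist ((γ : X ≃ᵢ X) 0) x ≤ R →
      ∃ l : List T, (l.map Subtype.val).prod = γ := by
    intro k
    induction k with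
    | zero =>
      intro x hx γ hγ
      obtain rfl : x = 0 := by simpa using hx
      have hT : γ ∈ T := by
        rw [dist_zero_right] at hγ
        change ‖(γ : X ≃ᵢ X) 0‖ ≤ 2 * R + 1
        linarith
      exact ⟨[⟨γ, hT⟩], by simp⟩
    | succ k ih =>
      intro x hx γ hγ
      obtain ⟨y, hy, hxy⟩ : ∃ y : X, ‖y‖ ≤ k ∧ dist y x ≤ 1 := by
        have hk : (0 : ℝ) < k + 1 := by positivity
        push_cast at hx
        refine ⟨((k : ℝ) / (k + 1)) • x, ?_, ?_⟩
        · rw [norm_smul, Real.norm_of_nonneg (by positivity), div_mul_eq_mul_div, div_le_iff₀ hk]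
          gcongr
        · have h : ((k : ℝ) / (k + 1)) • x - x = (-(1 / ((k : ℝ) + 1))) • x := by
            match_scalars
            field_simp
            ring
          rw [dist_eq_norm, h, norm_smul, norm_neg, Real.norm_of_nonneg (by positivity),
            div_mul_eq_mul_div, div_le_iff₀ hk]
          linarith
      obtain ⟨δ, hδ⟩ := hnear y
      obtain ⟨l, hl⟩ := ih y hy δ hδ
      have hT : δ⁻¹ * γ ∈ T := by
        have h₁ : dist ((γ : X ≃ᵢ X) 0) ((δ : X ≃ᵢ X) 0) ≤ 2 * R + 1 := by
          have h₂ := dist_triangle4_right ((γ : X ≃ᵢ X) 0) ((δ : X ≃ᵢ X) 0) x y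
          rw [dist_comm x y] at h₂
          linarith
        change ‖((δ : X ≃ᵢ X)⁻¹ * (γ : X ≃ᵢ X)) 0‖ ≤ 2 * R + 1
        rw [← dist_zero_right, ← (δ : X ≃ᵢ X).dist_eq]
        simpa using h₁
      exact ⟨l ++ [⟨δ⁻¹ * γ, hT⟩], by simp [hl]⟩
  intro γ
  obtain ⟨k, hk⟩ := exists_nat_ge ‖(γ : X ≃ᵢ X) 0‖
  exact key k _ hk γ (by simpa using hR)

section Words

variable {G : Type*} [Group G] {T : Set G}

/-- The group element represented by a word in `T`. -/
def wordProd (l : List T) : G := (l.map Subtype.val).prod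

@[simp] lemma wordProd_nil : wordProd ([] : List T) = 1 := rfl

@[simp] lemma wordProd_cons (t : T) (l : List T) : wordProd (t :: l) = t * wordProd l := by
  simp [wordProd]

lemma wordProd_append (l m : List T) : wordProd (l ++ m) = wordProd l * wordProd m := by
  simp [wordProd]

end Words

section WordEvaluation

variable {X : Type*} [NormedAddCommGroup X] [InnerProductSpace ℝ X]
  {Γ : Subgroup (X ≃ᵢ X)} {T : Set Γ}

/-- The value on a word of the crossed homomorphism with prescribed values on the letters,
as a linear function of the prescribed values. -/
def wordEval : List T → (T → X) →ₗ[ℝ] X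
  | [] => 0
  | t :: l => LinearMap.proj t +
      (linPart ((t : Γ) : X ≃ᵢ X)).toLinearEquiv.toLinearMap ∘ₗ wordEval l

@[simp] lemma wordEval_nil (x : T → X) : wordEval [] x = 0 := rfl

@[simp] lemma wordEval_cons (t : T) (l : List T) (x : T → X) :
    wordEval (t :: l) x = x t + linPart ((t : Γ) : X ≃ᵢ X) (wordEval l x) := rfl

lemma wordEval_append (l m : List T) (x : T → X) :
    wordEval (l ++ m) x = wordEval l x + linPart ((wordProd l : Γ) : X ≃ᵢ X) (wordEval m x) := by
  induction l with
  | nil => simp [linPart_one]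
  | cons t l ih => simp [ih, linPart_mul, add_assoc]

lemma wordEval_mem_centerSpan {N : Subgroup (X ≃ᵢ X)} (hN : ∀ γ ∈ Γ, ∀ ν ∈ N, γ * ν * γ⁻¹ ∈ N)
    {x : T → X} (hx : ∀ t, x t ∈ centerSpan N) (l : List T) : wordEval l x ∈ centerSpan N := by
  induction l with
  | nil => simp
  | cons t l ih => exact add_mem (hx t) (linPart_mem_centerSpan hN (t : Γ).2 ih)

/-- The differences of the evaluation maps at pairs of words that agree modulo `N`. -/
def relators (T : Set Γ) (N : Subgroup (X ≃ᵢ X)) : Set ((T → X) →ₗ[ℝ] X) :=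
  {d | ∃ l m : List T, ((wordProd l * (wordProd m)⁻¹ : Γ) : X ≃ᵢ X) ∈ N ∧
    d = wordEval l - wordEval m}

end WordEvaluation

section Cocycles

variable {n : ℕ} {Γ N : Subgroup (EuclideanSpace ℝ (Fin n) ≃ᵢ EuclideanSpace ℝ (Fin n))}
  {T : Set Γ}

lemma IsNCocycleModL.sub_wordEval_mem {f : Γ → EuclideanSpace ℝ (Fin n)}
    (hf : IsNCocycleModL Γ N f) (hN : ∀ γ ∈ Γ, ∀ ν ∈ N, γ * ν * γ⁻¹ ∈ N)
    {x : T → EuclideanSpace ℝ (Fin n)} (hx : ∀ t : T, f t - x t ∈ centralLattice N) (l : List T) :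
    f (wordProd l) - wordEval l x ∈ centralLattice N := by
  have hmul (γ₁ γ₂ : Γ) : f (γ₁ * γ₂) - (f γ₁ + linPart γ₁.1 (f γ₂)) ∈ centralLattice N :=
    hf.2.2 γ₁ γ₂ _ _ (parts_linPart _)
  induction l with
  | nil =>
    have h := neg_mem (hmul 1 1)
    simpa [linPart_one] using h
  | cons t l ih =>
    have h := add_mem (add_mem (hmul t (wordProd l)) (hx t))
      (linPart_mem_centralLattice hN (t : Γ).2 ih)
    rw [map_sub] at h
    rw [wordProd_cons, wordEval_cons]
    convert h using 1
    abel

lemma IsNCocycleModL.relator_mem {f : Γ → EuclideanSpace ℝ (Fin n)}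
    (hf : IsNCocycleModL Γ N f) (hN : ∀ γ ∈ Γ, ∀ ν ∈ N, γ * ν * γ⁻¹ ∈ N)
    {x : T → EuclideanSpace ℝ (Fin n)} (hx : ∀ t : T, f t - x t ∈ centralLattice N)
    {d : (T → EuclideanSpace ℝ (Fin n)) →ₗ[ℝ] EuclideanSpace ℝ (Fin n)} (hd : d ∈ relators T N) :
    d x ∈ centralLattice N := by
  obtain ⟨l, m, hlm, rfl⟩ := hd
  have h₁ : f (wordProd l) - f (wordProd m) ∈ centralLattice N := by
    have h := hf.2.1 _ (wordProd m) hlm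
    rwa [inv_mul_cancel_right] at h
  have h := add_mem (sub_mem h₁ (hf.sub_wordEval_mem hN hx l)) (hf.sub_wordEval_mem hN hx m)
  rw [LinearMap.sub_apply]
  convert h using 1
  abel

/-- Values on generators that kill all relators extend to a crossed homomorphism. -/
lemma isNCocycleToW_wordEval (hN : ∀ γ ∈ Γ, ∀ ν ∈ N, γ * ν * γ⁻¹ ∈ N)
    {x : T → EuclideanSpace ℝ (Fin n)} (hxW : ∀ t, x t ∈ centerSpan N)
    (hx : ∀ d ∈ relators T N, d x = 0) {word : Γ → List T}
    (hword : ∀ γ, wordProd (word γ) = γ) :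
    IsNCocycleToW Γ N fun γ => wordEval (word γ) x := by
  have heq (l m : List T) (h : ((wordProd l * (wordProd m)⁻¹ : Γ) :
      EuclideanSpace ℝ (Fin n) ≃ᵢ EuclideanSpace ℝ (Fin n)) ∈ N) : wordEval l x = wordEval m x :=
    sub_eq_zero.1 (hx _ ⟨l, m, h, rfl⟩)
  refine ⟨fun γ => wordEval_mem_centerSpan hN hxW _, fun ν γ hν => ?_, fun γ₁ γ₂ b B hB => ?_⟩
  · refine heq _ _ ?_
    rwa [hword, hword, mul_inv_cancel_right]
  · have h := heq (word (γ₁ * γ₂)) (word γ₁ ++ word γ₂) (by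
      rw [wordProd_append, hword, hword, hword, mul_inv_cancel]
      exact N.one_mem)
    change wordEval (word (γ₁ * γ₂)) x = _
    rw [h, wordEval_append, hword, hB.linPart_apply]

end Cocycles

/-- **Lemma 10**: the cokernel of `κ_* : H¹(Γ/N, W) → H¹(Γ/N, 𝒦)` is finite, where
`W = Span(Z(N))`, `L = {u : u + I ∈ Z(N)}` and `𝒦 = W/L`: finitely many cocycles
represent all cosets of the image of `κ_*`. -/
theorem cokernel_h1_kappa_finite {n : ℕ}
    (Γ N : Subgroup (EuclideanSpace ℝ (Fin n) ≃ᵢ EuclideanSpace ℝ (Fin n)))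
    (hΓ : IsSpaceGroup Γ) (hN : IsCompleteNormal Γ N) :
    ∃ S : Set (Γ → EuclideanSpace ℝ (Fin n)), S.Finite ∧
      (∀ g ∈ S, IsNCocycleModL Γ N g) ∧
      ∀ f, IsNCocycleModL Γ N f →
        ∃ g ∈ S, ∃ F, IsNCocycleToW Γ N F ∧
          ∃ w ∈ centerSpan N, ∀ (γ : Γ) (b : EuclideanSpace ℝ (Fin n))
            (B : EuclideanSpace ℝ (Fin n) ≃ₗᵢ[ℝ] EuclideanSpace ℝ (Fin n)),
            parts (γ : EuclideanSpace ℝ (Fin n) ≃ᵢ EuclideanSpace ℝ (Fin n)) b B →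
            f γ - (g γ + F γ) - (B w - w) ∈ Lset N := by
  have hnorm := hN.2.1
  obtain ⟨T, hTfin, hT⟩ := hΓ.exists_finite_generating
  have := hTfin.fintype
  choose word hword using hT
  obtain ⟨C, hC⟩ := (centralLattice N).exists_forall_mem_span_norm_sub_le
  have hC' : ∀ f, IsNCocycleModL Γ N f → ∀ t : T, ∃ y, f t - y ∈ centralLattice N ∧ ‖y‖ ≤ C :=
    fun f hf t => hC _ (hf.1 t)
  choose! x hxL hxC using hC'
  obtain ⟨s, hsrel, hs⟩ := Submodule.fg_span_iff_fg_span_finset_subset (relators T N) |>.1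
    (IsNoetherian.noetherian (Submodule.span ℝ (relators T N)))
  let c (f : Γ → EuclideanSpace ℝ (Fin n)) (d : s) : EuclideanSpace ℝ (Fin n) := d.1 (x f)
  have hfin : (c '' {f | IsNCocycleModL Γ N f}).Finite := by
    refine (Set.Finite.pi' fun d : s => finite_centralLattice_norm_le hΓ hN.1
      (‖d.1.toContinuousLinearMap‖ * max C 0)).subset ?_
    rintro _ ⟨f, hf, rfl⟩ d
    refine ⟨hf.relator_mem hnorm (hxL f hf) (hsrel d.2), ?_⟩
    refine (d.1.toContinuousLinearMap.le_opNorm (x f)).trans ?_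
    gcongr
    exact (pi_norm_le_iff_of_nonneg (le_max_right _ _)).2
      fun t => (hxC f hf t).trans (le_max_left _ _)
  obtain ⟨S, hS, hbij⟩ := Set.exists_subset_bijOn {f | IsNCocycleModL Γ N f} c
  refine ⟨S, hbij.finite_iff_finite.2 hfin, fun g hg => hS hg, fun f hf => ?_⟩
  obtain ⟨g, hgS, hgf⟩ := hbij.surjOn (Set.mem_image_of_mem c hf)
  have hg : IsNCocycleModL Γ N g := hS hgS
  have hxW : ∀ h, IsNCocycleModL Γ N h → ∀ t : T, x h t ∈ centerSpan N := fun h hh t => by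
    have h₁ := sub_mem (hh.1 t) (Submodule.subset_span (hxL h hh t) : _ ∈ centerSpan N)
    rwa [sub_sub_cancel] at h₁
  have hker : ∀ d ∈ relators T N, d (x f - x g) = 0 := by
    have hle : Submodule.span ℝ (relators T N) ≤
        LinearMap.ker (LinearMap.applyₗ (R := ℝ) (M₂ := EuclideanSpace ℝ (Fin n)) (x f - x g)) := by
      rw [hs, Submodule.span_le]
      intro d hd
      have h := congr_fun hgf ⟨d, hd⟩
      simp only [SetLike.mem_coe, LinearMap.mem_ker, map_sub]
      exact sub_eq_zero.2 h.symm
    exact fun d hd => hle (Submodule.subset_span hd)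
  refine ⟨g, hgS, _, isNCocycleToW_wordEval hnorm (x := x f - x g)
    (fun t => sub_mem (hxW f hf t) (hxW g hg t)) hker hword, 0, zero_mem _, fun γ b B _ => ?_⟩
  have hf' := hf.sub_wordEval_mem hnorm (hxL f hf) (word γ)
  have hg' := hg.sub_wordEval_mem hnorm (hxL g hg) (word γ)
  have hwγ : wordProd (word γ) = γ := hword γ
  rw [hwγ] at hf' hg'
  rw [map_zero, sub_zero, sub_zero, map_sub, ← mem_centralLattice]
  convert sub_mem hf' hg' using 1
  abel
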